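/- Künneth in low degree: for chain complexes C and D of free abelian groups in nonnegative degrees, there is an isomorphism H₁(C ⊗ D) ≅ (H₁(C) ⊗ H₀(D)) ⊕ (H₀(C) ⊗ H₁(D)) ⊕ Tor₁^ℤ(H₀(C), H₀(D)). -/

import Mathlib

open CategoryTheory Limits MonoidalCategory

noncomputable instance : (curriedTensor (ModuleCat.{0} ℤ)).PreservesZeroMorphisms where
  map_zero X Y := by
    apply NatTrans.ext
    funext Z
    simp [curriedTensor]

noncomputable instance (X : ModuleCat.{0} ℤ) :
    ((curriedTensor (ModuleCat.{0} ℤ)).obj X).PreservesZeroMorphisms :=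
  inferInstanceAs (tensorLeft X).PreservesZeroMorphisms

/-- The total tensor product complex `C ⊗ D` of two chain complexes of `ℤ`-modules,
with `(C ⊗ D)_n = ⊕_{p+q=n} C_p ⊗ D_q` and the usual signed differential. -/
noncomputable abbrev tensorComplex (C D : ChainComplex (ModuleCat.{0} ℤ) ℕ) :
    ChainComplex (ModuleCat.{0} ℤ) ℕ :=
  HomologicalComplex.mapBifunctor C D (curriedTensor (ModuleCat ℤ)) (ComplexShape.down ℕ)



section LA
open TensorProduct

/-- A split presentation of the low degree part of a complex `X₂ → X₁ → P`. -/
structure LowData (R : Type) [CommRing R] (X₂ X₁ P Z B H M : Type)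
    [AddCommGroup X₂] [AddCommGroup X₁] [AddCommGroup P] [AddCommGroup Z] [AddCommGroup B]
    [AddCommGroup H] [AddCommGroup M]
    [Module R X₂] [Module R X₁] [Module R P] [Module R Z] [Module R B]
    [Module R H] [Module R M] where
  j : Z →ₗ[R] X₁
  q : X₁ →ₗ[R] B
  σ : B →ₗ[R] X₁
  r : X₁ →ₗ[R] Z
  ι : B →ₗ[R] P
  β : X₂ →ₗ[R] Z
  ρ : Z →ₗ[R] H
  π : P →ₗ[R] M
  rj : r ∘ₗ j = LinearMap.id
  qσ : q ∘ₗ σ = LinearMap.id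
  rσ : r ∘ₗ σ = 0
  qj : q ∘ₗ j = 0
  split : j ∘ₗ r + σ ∘ₗ q = LinearMap.id
  ιinj : Function.Injective ι
  ρsurj : Function.Surjective ρ
  πsurj : Function.Surjective π
  exρ : Function.Exact β ρ
  exπ : Function.Exact ι π

lemma tmm {R : Type} [CommRing R] {A A' A'' E E' E'' : Type} [AddCommGroup A] [AddCommGroup A'] [AddCommGroup A'']
    [AddCommGroup E] [AddCommGroup E'] [AddCommGroup E'']
    [Module R A] [Module R A'] [Module R A''] [Module R E] [Module R E'] [Module R E'']
    (f : A →ₗ[R] A') (f' : A' →ₗ[R] A'') (g : E →ₗ[R] E') (g' : E' →ₗ[R] E'') (x : A ⊗[R] E) :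
    TensorProduct.map f' g' (TensorProduct.map f g x) =
      TensorProduct.map (f' ∘ₗ f) (g' ∘ₗ g) x := by
  rw [TensorProduct.map_comp]; rfl

variable {R : Type} [CommRing R] {X₂ X₁ P Z B H M Y₂ Y₁ P' Z' B' H' M' : Type}
    [AddCommGroup X₂] [AddCommGroup X₁] [AddCommGroup P] [AddCommGroup Z] [AddCommGroup B]
    [AddCommGroup H] [AddCommGroup M]
    [Module R X₂] [Module R X₁] [Module R P] [Module R Z] [Module R B]
    [Module R H] [Module R M]
    [AddCommGroup Y₂] [AddCommGroup Y₁] [AddCommGroup P'] [AddCommGroup Z'] [AddCommGroup B']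
    [AddCommGroup H'] [AddCommGroup M']
    [Module R Y₂] [Module R Y₁] [Module R P'] [Module R Z'] [Module R B']
    [Module R H'] [Module R M']
    (S : LowData R X₂ X₁ P Z B H M) (T : LowData R Y₂ Y₁ P' Z' B' H' M')

local notation "𝟭" => LinearMap.id (R := R) 
local notation "tm" => TensorProduct.map (R := R) 

lemma low_surj (h : H ⊗[R] M') (h' : M ⊗[R] H') (k : M ⊗[R] B') (hk : tm 𝟭 T.ι k = 0) :
    ∃ (u : X₁ ⊗[R] P') (v : P ⊗[R] Y₁),
      tm (S.ι ∘ₗ S.q) 𝟭 u + tm 𝟭 (T.ι ∘ₗ T.q) v = 0 ∧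
      tm (S.ρ ∘ₗ S.r) T.π u = h ∧ tm S.π (T.ρ ∘ₗ T.r) v = h' ∧ tm S.π T.q v = k := by
  obtain ⟨s, rfl⟩ := TensorProduct.map_surjective S.ρsurj T.πsurj h
  obtain ⟨t, rfl⟩ := TensorProduct.map_surjective S.πsurj T.ρsurj h'
  obtain ⟨w, rfl⟩ := TensorProduct.map_surjective S.πsurj (show Function.Surjective (𝟭 : B' →ₗ[R] B') from Function.surjective_id) k
  obtain ⟨e, he⟩ := ((rTensor_exact P' S.exπ S.πsurj) (tm 𝟭 T.ι w)).1 (by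
    rw [LinearMap.rTensor, tmm]; rw [tmm] at hk; exact hk)
  rw [LinearMap.rTensor] at he
  have h1 := S.rj
  have h2 := S.rσ
  have h3 := S.qσ
  have h4 := S.qj
  have h1' := T.rj
  have h2' := T.rσ
  have h3' := T.qσ
  have h4' := T.qj
  refine ⟨tm S.j 𝟭 s - tm S.σ 𝟭 e, tm 𝟭 T.j t + tm 𝟭 T.σ w, ?_, ?_, ?_, ?_⟩ <;>
  simp [tmm, LinearMap.comp_assoc, h1, h2, h3, h4, h1', h2', h3', h4', he]

lemma low_cyc (u : X₁ ⊗[R] P') (v : P ⊗[R] Y₁)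
    (h : tm (S.ι ∘ₗ S.q) 𝟭 u + tm 𝟭 (T.ι ∘ₗ T.q) v = 0) :
    tm 𝟭 T.ι (tm S.π T.q v) = 0 := by
  have := congrArg (tm S.π 𝟭) h
  simpa [tmm, ← LinearMap.comp_assoc, S.exπ.linearMap_comp_eq_zero] using this

lemma low_bd (x : X₂ ⊗[R] P') (y : X₁ ⊗[R] Y₁) (z : P ⊗[R] Y₂) :
    tm (S.ρ ∘ₗ S.r) T.π (tm (S.j ∘ₗ S.β) 𝟭 x - tm 𝟭 (T.ι ∘ₗ T.q) y) = 0 ∧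
    tm S.π (T.ρ ∘ₗ T.r) (tm (S.ι ∘ₗ S.q) 𝟭 y + tm 𝟭 (T.j ∘ₗ T.β) z) = 0 ∧
    tm S.π T.q (tm (S.ι ∘ₗ S.q) 𝟭 y + tm 𝟭 (T.j ∘ₗ T.β) z) = 0 := by
  have e1 : S.ρ ∘ₗ S.r ∘ₗ S.j ∘ₗ S.β = 0 := by
    rw [← LinearMap.comp_assoc S.β, S.rj, LinearMap.id_comp, S.exρ.linearMap_comp_eq_zero]
  have e2 : T.ρ ∘ₗ T.r ∘ₗ T.j ∘ₗ T.β = 0 := by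
    rw [← LinearMap.comp_assoc T.β, T.rj, LinearMap.id_comp, T.exρ.linearMap_comp_eq_zero]
  have e3 : T.q ∘ₗ T.j ∘ₗ T.β = 0 := by
    rw [← LinearMap.comp_assoc T.β, T.qj, LinearMap.zero_comp]
  have e4 : S.π ∘ₗ S.ι ∘ₗ S.q = 0 := by
    rw [← LinearMap.comp_assoc, S.exπ.linearMap_comp_eq_zero, LinearMap.zero_comp]
  have e5 : T.π ∘ₗ T.ι ∘ₗ T.q = 0 := by
    rw [← LinearMap.comp_assoc, T.exπ.linearMap_comp_eq_zero, LinearMap.zero_comp]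
  refine ⟨?_, ?_, ?_⟩ <;> simp [tmm, LinearMap.comp_assoc, e1, e2, e3, e4, e5]

lemma low_ker [Module.Flat R P'] (u : X₁ ⊗[R] P') (v : P ⊗[R] Y₁)
    (hc : tm (S.ι ∘ₗ S.q) 𝟭 u + tm 𝟭 (T.ι ∘ₗ T.q) v = 0)
    (h1 : tm (S.ρ ∘ₗ S.r) T.π u = 0) (h2 : tm S.π (T.ρ ∘ₗ T.r) v = 0) (h3 : tm S.π T.q v = 0) :
    ∃ (x : X₂ ⊗[R] P') (y : X₁ ⊗[R] Y₁) (z : P ⊗[R] Y₂),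
      u = tm (S.j ∘ₗ S.β) 𝟭 x - tm 𝟭 (T.ι ∘ₗ T.q) y ∧
      v = tm (S.ι ∘ₗ S.q) 𝟭 y + tm 𝟭 (T.j ∘ₗ T.β) z := by
  have k1 : tm S.r 𝟭 u ∈ LinearMap.ker (tm S.ρ T.π) := by
    rw [LinearMap.mem_ker, tmm]; exact h1
  have k2 : tm 𝟭 T.r v ∈ LinearMap.ker (tm S.π T.ρ) := by
    rw [LinearMap.mem_ker, tmm]; exact h2
  rw [TensorProduct.map_ker S.exρ S.ρsurj T.exπ T.πsurj, Submodule.mem_sup] at k1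
  rw [TensorProduct.map_ker S.exπ S.πsurj T.exρ T.ρsurj, Submodule.mem_sup] at k2
  obtain ⟨_, ⟨s, rfl⟩, _, ⟨x, rfl⟩, k1⟩ := k1
  obtain ⟨_, ⟨z, rfl⟩, _, ⟨t, rfl⟩, k2⟩ := k2
  obtain ⟨w, hw⟩ := ((rTensor_exact B' S.exπ S.πsurj) (tm 𝟭 T.q v)).1 (by
    rw [LinearMap.rTensor, tmm]; exact h3)
  rw [LinearMap.rTensor] at hw
  rw [LinearMap.rTensor, LinearMap.lTensor] at k1 k2
  have hu : tm S.q 𝟭 u = - tm 𝟭 T.ι w := by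
    apply Module.Flat.rTensor_preserves_injective_linearMap (M := P') S.ι S.ιinj
    have : tm 𝟭 (T.ι ∘ₗ T.q) v = tm S.ι T.ι w := by
      have := congrArg (tm 𝟭 T.ι) hw
      simpa [tmm] using this.symm
    rw [this] at hc
    simp only [LinearMap.rTensor, map_neg, tmm]
    exact eq_neg_of_add_eq_zero_left hc
  have du : u = tm S.j 𝟭 (tm S.r 𝟭 u) + tm S.σ 𝟭 (tm S.q 𝟭 u) := by
    rw [tmm, tmm, ← LinearMap.add_apply, LinearMap.id_comp, ← TensorProduct.map_add_left, S.split,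
      TensorProduct.map_id, LinearMap.id_apply]
  have dv : v = tm 𝟭 T.j (tm 𝟭 T.r v) + tm 𝟭 T.σ (tm 𝟭 T.q v) := by
    rw [tmm, tmm, ← LinearMap.add_apply, LinearMap.id_comp, ← TensorProduct.map_add_right, T.split,
      TensorProduct.map_id, LinearMap.id_apply]
  have g3 := S.qσ
  have g4 := S.qj
  have g3' := T.qσ
  have g4' := T.qj
  refine ⟨x, - tm S.j T.σ s + tm S.σ T.j t + tm S.σ T.σ w, z, ?_, ?_⟩
  · rw [du, ← k1, hu]
    simp [tmm, LinearMap.comp_assoc, g3, g4, g3', g4']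
    abel
  · rw [dv, ← k2, ← hw]
    simp [tmm, LinearMap.comp_assoc, g3, g4, g3', g4']
    abel

theorem low_main [Module.Flat R P'] {W₂ W₁ W₀ : Type} [AddCommGroup W₂] [AddCommGroup W₁]
    [AddCommGroup W₀] [Module R W₂] [Module R W₁] [Module R W₀]
    (F : W₂ →ₗ[R] W₁) (G : W₁ →ₗ[R] W₀) (hGF : ∀ x, G (F x) = 0)
    (e : W₁ ≃ₗ[R] (X₁ ⊗[R] P') × (P ⊗[R] Y₁))
    (hG : ∀ w, G w = 0 ↔ tm (S.ι ∘ₗ S.q) 𝟭 (e w).1 + tm 𝟭 (T.ι ∘ₗ T.q) (e w).2 = 0)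
    (hF : ∀ w, w ∈ LinearMap.range F ↔ ∃ (x : X₂ ⊗[R] P') (y : X₁ ⊗[R] Y₁) (z : P ⊗[R] Y₂),
      (e w).1 = tm (S.j ∘ₗ S.β) 𝟭 x - tm 𝟭 (T.ι ∘ₗ T.q) y ∧
      (e w).2 = tm (S.ι ∘ₗ S.q) 𝟭 y + tm 𝟭 (T.j ∘ₗ T.β) z) :
    Nonempty ((LinearMap.ker G ⧸ LinearMap.range (F.codRestrict (LinearMap.ker G) hGF)) ≃ₗ[R]
      ((H ⊗[R] M') × (M ⊗[R] H') × LinearMap.ker (LinearMap.lTensor M T.ι))) := by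
  let f1 : LinearMap.ker G →ₗ[R] X₁ ⊗[R] P' :=
    LinearMap.fst R _ _ ∘ₗ e.toLinearMap ∘ₗ (LinearMap.ker G).subtype
  let f2 : LinearMap.ker G →ₗ[R] P ⊗[R] Y₁ :=
    LinearMap.snd R _ _ ∘ₗ e.toLinearMap ∘ₗ (LinearMap.ker G).subtype
  have hc : ∀ w : LinearMap.ker G,
      tm (S.ι ∘ₗ S.q) 𝟭 (f1 w) + tm 𝟭 (T.ι ∘ₗ T.q) (f2 w) = 0 := fun w => (hG w).1 w.2
  let ψ : LinearMap.ker G →ₗ[R]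
      (H ⊗[R] M') × (M ⊗[R] H') × LinearMap.ker (LinearMap.lTensor M T.ι) :=
    ((tm (S.ρ ∘ₗ S.r) T.π) ∘ₗ f1).prod (((tm S.π (T.ρ ∘ₗ T.r)) ∘ₗ f2).prod
      (((tm S.π T.q) ∘ₗ f2).codRestrict _ (fun w => low_cyc S T _ _ (hc w))))
  have hψ : Function.Surjective ψ := by
    rintro ⟨h, h', k, hk⟩
    obtain ⟨u, v, hg, h1, h2, h3⟩ := low_surj S T h h' k hk
    refine ⟨⟨e.symm (u, v), (hG _).2 (by simpa using hg)⟩, ?_⟩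
    refine Prod.ext ?_ (Prod.ext ?_ (Subtype.ext ?_))
    · simpa [ψ, f1, f2] using h1
    · simpa [ψ, f1, f2] using h2
    · change tm S.π T.q (e (e.symm (u, v))).2 = k
      simpa using h3
  have hk : LinearMap.ker ψ = LinearMap.range (F.codRestrict (LinearMap.ker G) hGF) := by
    ext w
    have : w ∈ LinearMap.range (F.codRestrict (LinearMap.ker G) hGF) ↔
        w.1 ∈ LinearMap.range F := by
      simp only [LinearMap.mem_range, Subtype.ext_iff]
      rfl
    rw [this, hF, LinearMap.mem_ker]
    constructor
    · intro h
      have h1 : tm (S.ρ ∘ₗ S.r) T.π (f1 w) = 0 := congrArg Prod.fst h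
      have h2 : tm S.π (T.ρ ∘ₗ T.r) (f2 w) = 0 := congrArg (fun p => p.2.1) h
      have h3 : tm S.π T.q (f2 w) = 0 := congrArg (fun p => (p.2.2 : M ⊗[R] B')) h
      exact low_ker S T _ _ (hc w) h1 h2 h3
    · rintro ⟨x, y, z, hx, hz⟩
      obtain ⟨h1, h2, h3⟩ := low_bd S T x y z
      rw [← hx] at h1
      rw [← hz] at h2 h3
      exact Prod.ext h1 (Prod.ext h2 (Subtype.ext h3))
  exact ⟨(Submodule.quotEquivOfEq _ _ hk.symm).trans (ψ.quotKerEquivOfSurjective hψ)⟩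

/-- The corestriction of `a` to its range has a section. -/
def HasSec {R A P : Type} [CommRing R] [AddCommGroup A] [AddCommGroup P] [Module R A] [Module R P]
    (a : A →ₗ[R] P) : Prop :=
  ∃ σ : LinearMap.range a →ₗ[R] A, a.rangeRestrict ∘ₗ σ = LinearMap.id

theorem HasSec.mk {R A P : Type} [CommRing R] [AddCommGroup A] [AddCommGroup P] [Module R A]
    [Module R P] (a : A →ₗ[R] P) (s : LinearMap.range a → A)
    (h0 : ∀ x y, s (x + y) = s x + s y) (h1 : ∀ (r : R) x, s (r • x) = r • s x)
    (h2 : ∀ y, a (s y) = y.1) : HasSec a :=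
  ⟨⟨⟨s, h0⟩, h1⟩, LinearMap.ext fun y => Subtype.ext (h2 y)⟩

/-- Existence of the split presentation. -/
theorem exists_low (b : X₂ →ₗ[R] X₁) (a : X₁ →ₗ[R] P)
    (hab : ∀ x, b x ∈ LinearMap.ker a)
    (ρ : LinearMap.ker a →ₗ[R] H) (hρ : Function.Surjective ρ)
    (exρ : Function.Exact (b.codRestrict _ hab) ρ)
    (hs : HasSec a)
    (π : P →ₗ[R] M) (hπ : Function.Surjective π) (exπ : Function.Exact a π) :
    ∃ S : LowData R X₂ X₁ P (LinearMap.ker a) (LinearMap.range a) H M,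
      S.ι ∘ₗ S.q = a ∧ S.j ∘ₗ S.β = b ∧ S.ι = (LinearMap.range a).subtype ∧ S.π = π := by
  obtain ⟨σ, hσ⟩ := hs
  have hσ' : ∀ y, a (σ y) = y.1 := fun y => congrArg Subtype.val (LinearMap.congr_fun hσ y)
  have hr : ∀ x, (LinearMap.id - σ ∘ₗ a.rangeRestrict : X₁ →ₗ[R] X₁) x ∈ LinearMap.ker a := by
    intro x
    simp [hσ']
  refine ⟨{ j := (LinearMap.ker a).subtype, q := a.rangeRestrict, σ := σ,
            r := (LinearMap.id - σ ∘ₗ a.rangeRestrict).codRestrict _ hr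
            ι := (LinearMap.range a).subtype, β := b.codRestrict _ hab, ρ := ρ, π := π
            rj := ?_, qσ := hσ, rσ := ?_, qj := ?_, split := ?_
            ιinj := Subtype.val_injective, ρsurj := hρ, πsurj := hπ, exρ := exρ, exπ := ?_ },
            ?_, ?_, rfl, rfl⟩
  · ext x
    have : a.rangeRestrict x.1 = 0 := Subtype.ext x.2
    simp [this]
  · ext x
    have : a.rangeRestrict (σ x) = x := LinearMap.congr_fun hσ x
    simp [this]
  · ext x
    simp
  · ext x
    simp
  · intro y
    rw [exπ y]
    simp
  · rfl
  · rfl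

theorem exists_section {A P : Type} [AddCommGroup A] [AddCommGroup P] [iA : Module ℤ A] [iP : Module ℤ P]
    [Module.Projective ℤ P] (a : A →ₗ[ℤ] P) : HasSec a := by
  obtain rfl : iA = AddCommGroup.toIntModule A := Subsingleton.elim _ _
  obtain rfl : iP = AddCommGroup.toIntModule P := Subsingleton.elim _ _
  let E := CharacterModule A → AddCircle (1 : ℚ)
  let k : A →+ E := 
    { toFun := fun x c => c x, map_zero' := by ext; simp; rfl, map_add' := by intros; ext; simp; rfl }
  have hk : Function.Injective k := (injective_iff_map_eq_zero _).2 fun x hx =>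
    CharacterModule.eq_zero_of_character_apply fun c => congrFun hx c
  let K : AddSubgroup E := AddSubgroup.map k a.toAddMonoidHom.ker
  let _ : DivisibleBy (E ⧸ K) ℤ := divisibleByOfSMulRightSurj _ _ (by
    intro n hn y
    obtain ⟨y, rfl⟩ := QuotientAddGroup.mk_surjective y
    refine ⟨QuotientAddGroup.mk (DivisibleBy.div y n), ?_⟩
    change QuotientAddGroup.mk (n • DivisibleBy.div y n) = _
    rw [DivisibleBy.div_cancel y hn])
  let p : E →+ E ⧸ K := QuotientAddGroup.mk' K
  let g : A →+ LinearMap.range a := a.rangeRestrict.toAddMonoidHom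
  have hg : Function.Surjective g := a.surjective_rangeRestrict
  have hker : g.ker ≤ (p.comp k).ker := by
    intro x hx
    have hx' : a x = 0 := congrArg Subtype.val hx
    change (QuotientAddGroup.mk (k x) : E ⧸ K) = 0
    rw [QuotientAddGroup.eq_zero_iff]
    exact ⟨x, hx', rfl⟩
  let t : LinearMap.range a →+ E ⧸ K := g.liftOfSurjective hg ⟨p.comp k, hker⟩
  have ht : ∀ x, t (g x) = p (k x) := fun x => g.liftOfRightInverse_comp_apply _ _ ⟨p.comp k, hker⟩ x
  obtain ⟨T, hT⟩ := (Module.Baer.of_divisible (E ⧸ K)).extension_property_addMonoidHom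
    (LinearMap.range a).subtype.toAddMonoidHom Subtype.val_injective t
  obtain ⟨L, hL⟩ := Module.projective_lifting_property p.toIntLinearMap T.toIntLinearMap
    (QuotientAddGroup.mk'_surjective K)
  have hL' : ∀ y, p (L y) = T y := fun y => LinearMap.congr_fun hL y
  have hT' : ∀ y : LinearMap.range a, T y.1 = t y := fun y => DFunLike.congr_fun hT y
  have key : ∀ y : LinearMap.range a, ∃ x, k x = L y.1 ∧ a x = y.1 := by
    intro y
    obtain ⟨x, rfl⟩ := hg y
    have h1 : p (L (a x)) = p (k x) := by
      rw [hL', ← ht, ← hT']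
      rfl
    have h2 := QuotientAddGroup.eq.1 h1.symm
    obtain ⟨z, hz, hz'⟩ := h2
    refine ⟨x + z, ?_, ?_⟩
    · rw [map_add, hz']
      change k x + (-k x + L (a x)) = L (a x)
      abel
    · have : a z = 0 := hz
      rw [map_add, this, add_zero]
      rfl
  choose s hs1 hs2 using key
  refine HasSec.mk a s ?_ ?_ hs2
  · intro x y
    apply hk
    rw [map_add, hs1, hs1, hs1, ← map_add]
    rfl
  · intro r x
    apply hk
    have e1 : k (r • s x) = r • k (s x) := map_zsmul k r (s x)
    rw [e1, hs1, hs1, ← map_smul]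
    rfl
end LA


section Cat
variable {R : Type} [CommRing R]

/-- Homology in degree `1`. -/
noncomputable def hom1 (K : ChainComplex (ModuleCat.{0} R) ℕ) :
    (K.homology 1 : ModuleCat R) ≃ₗ[R] (LinearMap.ker (K.d 1 0).hom ⧸
      LinearMap.range ((K.d 2 1).hom.codRestrict (LinearMap.ker (K.d 1 0).hom)
        (K.sc' 2 1 0).moduleCat_zero_apply)) :=
  (K.homologyIsoSc' 2 1 0 (by simp) (by simp) ≪≫ (K.sc' 2 1 0).moduleCatHomologyIso).toLinearEquiv

/-- Homology in degree `0`. -/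
noncomputable def hom0 (K : ChainComplex (ModuleCat.{0} R) ℕ) :
    (K.homology 0 : ModuleCat R) ≃ₗ[R] (LinearMap.ker (K.d 0 0).hom ⧸
      LinearMap.range ((K.d 1 0).hom.codRestrict (LinearMap.ker (K.d 0 0).hom)
        (K.sc' 1 0 0).moduleCat_zero_apply)) :=
  (K.homologyIsoSc' 1 0 0 (by simp) (by simp) ≪≫ (K.sc' 1 0 0).moduleCatHomologyIso).toLinearEquiv

lemma exists_rho (K : ChainComplex (ModuleCat.{0} R) ℕ) :
    ∃ ρ : LinearMap.ker (K.d 1 0).hom →ₗ[R] (K.homology 1 : ModuleCat R),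
      Function.Surjective ρ ∧ Function.Exact ((K.d 2 1).hom.codRestrict
        (LinearMap.ker (K.d 1 0).hom) (K.sc' 2 1 0).moduleCat_zero_apply) ρ := by
  refine ⟨(hom1 K).symm.toLinearMap ∘ₗ Submodule.mkQ _, ?_, ?_⟩
  · exact (hom1 K).symm.surjective.comp (Submodule.mkQ_surjective _)
  · intro y
    simp only [LinearMap.comp_apply, LinearEquiv.coe_coe, LinearEquiv.map_eq_zero_iff,
      Submodule.mkQ_apply, Submodule.Quotient.mk_eq_zero]
    rfl

lemma exists_pi (K : ChainComplex (ModuleCat.{0} R) ℕ) :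
    ∃ π : K.X 0 →ₗ[R] (K.homology 0 : ModuleCat R),
      Function.Surjective π ∧ Function.Exact (K.d 1 0).hom π := by
  have h00 : K.d 0 0 = 0 := K.shape _ _ (by simp)
  have h : ∀ x, (LinearMap.id : K.X 0 →ₗ[R] K.X 0) x ∈ LinearMap.ker (K.d 0 0).hom := by
    intro x; simp [h00]
  refine ⟨(hom0 K).symm.toLinearMap ∘ₗ Submodule.mkQ _ ∘ₗ LinearMap.id.codRestrict _ h, ?_, ?_⟩
  · refine (hom0 K).symm.surjective.comp ((Submodule.mkQ_surjective _).comp ?_)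
    rintro ⟨x, hx⟩
    exact ⟨x, rfl⟩
  · intro y
    simp only [LinearMap.comp_apply, LinearEquiv.coe_coe, LinearEquiv.map_eq_zero_iff,
      Submodule.mkQ_apply, Submodule.Quotient.mk_eq_zero]
    simp only [LinearMap.mem_range, Subtype.ext_iff, Set.mem_range]
    rfl

/-- The two term complex. -/
def twoTerm {B P : ModuleCat.{0} R} (f : B ⟶ P) : ChainComplex (ModuleCat.{0} R) ℕ where
  X := fun n => match n with
    | 0 => P
    | 1 => B
    | _ + 2 => ModuleCat.of R PUnit
  d := fun i j => match i, j with
    | 1, 0 => f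
    | 0, _ => 0
    | 1, _ + 1 => 0
    | _ + 2, _ => 0
  shape := by
    rintro (_ | _ | i) (_ | j) h
    all_goals first | rfl | exact absurd rfl h
  d_comp_d' := by
    rintro (_ | _ | i) (_ | _ | j) (_ | k) h h'
    all_goals first | simp at h; done | simp at h'; done | exact zero_comp | exact comp_zero

/-- The resulting resolution. -/
noncomputable def twoRes {B P M : ModuleCat.{0} R} (f : B ⟶ P) (g : P ⟶ M) (hB : Projective B)
    (hP : Projective P) (hf : Function.Injective f) (hg : Function.Surjective g)
    (hfg : Function.Exact f g) : ProjectiveResolution M where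
  complex := twoTerm f
  projective := by
    rintro (_ | _ | n)
    · exact hP
    · exact hB
    · change Projective (ModuleCat.of R PUnit)
      infer_instance
  π := (ChainComplex.toSingle₀Equiv _ _).symm ⟨g, by
    ext x
    exact hfg.apply_apply_eq_zero x⟩
  quasiIso := ⟨fun n => by
    rcases n with _ | _ | n
    · rw [ChainComplex.quasiIsoAt₀_iff, ShortComplex.quasiIso_iff_of_zeros']
      · have hg' : Epi g := (ModuleCat.epi_iff_surjective _).2 hg
        refine (ShortComplex.exact_and_epi_g_iff_of_iso (S₂ := ShortComplex.mk f g (by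
          ext x; exact hfg.apply_apply_eq_zero x)) ?_).2 ⟨?_, hg'⟩
        · exact ShortComplex.isoMk (Iso.refl _) (Iso.refl _) (Iso.refl _)
            (by simp; rfl) (by simp; rfl)
        · exact ModuleCat.shortComplex_exact _ hfg
      all_goals rfl
    · rw [quasiIsoAt_iff_exactAt' _ _ (ChainComplex.exactAt_succ_single_obj _ _),
        HomologicalComplex.exactAt_iff' _ 2 1 0 (by simp) (by simp)]
      rw [ShortComplex.moduleCat_exact_iff]
      intro x hx
      refine ⟨0, ?_⟩
      rw [map_zero]
      exact (hf (hx.trans (map_zero _).symm)).symm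
    · rw [quasiIsoAt_iff_exactAt' _ _ (ChainComplex.exactAt_succ_single_obj _ _),
        HomologicalComplex.exactAt_iff' _ (n+3) (n+2) (n+1) (by simp) (by simp)]
      rw [ShortComplex.moduleCat_exact_iff]
      intro x hx
      exact ⟨0, rfl⟩⟩

lemma tor_one {B P M : ModuleCat.{0} R} (N : ModuleCat.{0} R)
    (f : B ⟶ P) (g : P ⟶ M) (hB : Projective B)
    (hP : Projective P) (hf : Function.Injective f) (hg : Function.Surjective g)
    (hfg : Function.Exact f g) :
    Nonempty ((((Tor (ModuleCat R) 1).obj N).obj M : ModuleCat R) ≃ₗ[R]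
      LinearMap.ker (LinearMap.lTensor N f.hom)) := by
  let Q := twoRes f g hB hP hf hg hfg
  let e1 := (Q.isoLeftDerivedObj ((tensoringLeft (ModuleCat R)).obj N) 1).toLinearEquiv
  let K := ((((tensoringLeft (ModuleCat R)).obj N).mapHomologicalComplex _).obj Q.complex)
  have h : K.d 2 1 = 0 := by
    change ((tensoringLeft (ModuleCat R)).obj N).map 0 = 0
    simp
  let e2 := hom1 K
  refine ⟨e1.trans (e2.trans ((Submodule.quotEquivOfEqBot _ ?_)))⟩
  rw [LinearMap.range_eq_bot]
  ext x
  change (K.d 2 1).hom x = 0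
  rw [h]
  rfl
end Cat
section Combo
variable {R : Type} [CommRing R]

lemma combo (K L W : ChainComplex (ModuleCat.{0} R) ℕ)
    (hK : HasSec (K.d 1 0).hom) (hL : HasSec (L.d 1 0).hom)
    (hP0 : Module.Projective R (L.X 0)) (hP1 : Module.Projective R (L.X 1))
    (i00 : K.X 0 ⊗ L.X 0 ⟶ W.X 0) (p00 : W.X 0 ⟶ K.X 0 ⊗ L.X 0) (h00 : i00 ≫ p00 = 𝟙 _)
    (i10 : K.X 1 ⊗ L.X 0 ⟶ W.X 1) (p10 : W.X 1 ⟶ K.X 1 ⊗ L.X 0) (h10 : i10 ≫ p10 = 𝟙 _)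
    (i01 : K.X 0 ⊗ L.X 1 ⟶ W.X 1) (p01 : W.X 1 ⟶ K.X 0 ⊗ L.X 1) (h01 : i01 ≫ p01 = 𝟙 _)
    (hz1 : i10 ≫ p01 = 0) (hz2 : i01 ≫ p10 = 0) (hs : p10 ≫ i10 + p01 ≫ i01 = 𝟙 _)
    (i20 : K.X 2 ⊗ L.X 0 ⟶ W.X 2) (p20 : W.X 2 ⟶ K.X 2 ⊗ L.X 0)
    (i11 : K.X 1 ⊗ L.X 1 ⟶ W.X 2) (p11 : W.X 2 ⟶ K.X 1 ⊗ L.X 1)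
    (i02 : K.X 0 ⊗ L.X 2 ⟶ W.X 2) (p02 : W.X 2 ⟶ K.X 0 ⊗ L.X 2)
    (ht : p20 ≫ i20 + p11 ≫ i11 + p02 ≫ i02 = 𝟙 _)
    (d10 : i10 ≫ W.d 1 0 = (K.d 1 0 ▷ L.X 0) ≫ i00)
    (d01 : i01 ≫ W.d 1 0 = (K.X 0 ◁ L.d 1 0) ≫ i00)
    (d20 : i20 ≫ W.d 2 1 = (K.d 2 1 ▷ L.X 0) ≫ i10)
    (d11 : i11 ≫ W.d 2 1 = (K.d 1 0 ▷ L.X 1) ≫ i01 - (K.X 1 ◁ L.d 1 0) ≫ i10)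
    (d02 : i02 ≫ W.d 2 1 = (K.X 0 ◁ L.d 2 1) ≫ i01) :
    Nonempty ((W.homology 1 : ModuleCat R) ≃ₗ[R]
      (TensorProduct R (K.homology 1 : ModuleCat R) (L.homology 0 : ModuleCat R) ×
        TensorProduct R (K.homology 0 : ModuleCat R) (L.homology 1 : ModuleCat R) ×
        (((Tor (ModuleCat R) 1).obj (K.homology 0)).obj (L.homology 0) : ModuleCat R))) := by
  obtain ⟨ρ, hρ, exρ⟩ := exists_rho K
  obtain ⟨ρ', hρ', exρ'⟩ := exists_rho L
  obtain ⟨π, hπ, exπ⟩ := exists_pi K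
  obtain ⟨π', hπ', exπ'⟩ := exists_pi L
  obtain ⟨S, hS1, hS2, hS3, hS4⟩ := exists_low (K.d 2 1).hom (K.d 1 0).hom
    (K.sc' 2 1 0).moduleCat_zero_apply ρ hρ exρ hK π hπ exπ
  obtain ⟨T, hT1, hT2, hT3, hT4⟩ := exists_low (L.d 2 1).hom (L.d 1 0).hom
    (L.sc' 2 1 0).moduleCat_zero_apply ρ' hρ' exρ' hL π' hπ' exπ'
  have hB : Module.Projective R (LinearMap.range (L.d 1 0).hom) := by
    obtain ⟨σ, hσ⟩ := hL
    exact Module.Projective.of_split σ _ hσ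
  obtain ⟨t⟩ := tor_one (K.homology 0)
    (ModuleCat.ofHom (LinearMap.range (L.d 1 0).hom).subtype) (ModuleCat.ofHom π')
    ((IsProjective.iff_projective _).1 hB) ((IsProjective.iff_projective _).1 hP0)
    (Submodule.subtype_injective _) hπ' (by
      intro y
      refine (exπ' y).trans ?_
      simp)
  -- elementwise versions
  have e10 : ∀ x, p10.hom (i10.hom x) = x := fun x => congrArg (fun f => f.hom x) h10
  have e01 : ∀ x, p01.hom (i01.hom x) = x := fun x => congrArg (fun f => f.hom x) h01
  have e00 : ∀ x, p00.hom (i00.hom x) = x := fun x => congrArg (fun f => f.hom x) h00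
  have ez1 : ∀ x, p01.hom (i10.hom x) = 0 := fun x => congrArg (fun f => f.hom x) hz1
  have ez2 : ∀ x, p10.hom (i01.hom x) = 0 := fun x => congrArg (fun f => f.hom x) hz2
  have es : ∀ x, i10.hom (p10.hom x) + i01.hom (p01.hom x) = x :=
    fun x => congrArg (fun f => f.hom x) hs
  have et : ∀ x, i20.hom (p20.hom x) + i11.hom (p11.hom x) + i02.hom (p02.hom x) = x :=
    fun x => congrArg (fun f => f.hom x) ht
  have f10 : ∀ x, (W.d 1 0).hom (i10.hom x) =
      i00.hom (TensorProduct.map (R := R) (K.d 1 0).hom LinearMap.id x) :=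
    fun x => congrArg (fun f => f.hom x) d10
  have f01 : ∀ x, (W.d 1 0).hom (i01.hom x) =
      i00.hom (TensorProduct.map (R := R) LinearMap.id (L.d 1 0).hom x) :=
    fun x => congrArg (fun f => f.hom x) d01
  have f20 : ∀ x, (W.d 2 1).hom (i20.hom x) =
      i10.hom (TensorProduct.map (R := R) (K.d 2 1).hom LinearMap.id x) :=
    fun x => congrArg (fun f => f.hom x) d20
  have f02 : ∀ x, (W.d 2 1).hom (i02.hom x) =
      i01.hom (TensorProduct.map (R := R) LinearMap.id (L.d 2 1).hom x) :=
    fun x => congrArg (fun f => f.hom x) d02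
  have f11 : ∀ x, (W.d 2 1).hom (i11.hom x) =
      i01.hom (TensorProduct.map (R := R) (K.d 1 0).hom LinearMap.id x) -
      i10.hom (TensorProduct.map (R := R) LinearMap.id (L.d 1 0).hom x) :=
    fun x => congrArg (fun f => f.hom x) d11
  let e : W.X 1 ≃ₗ[R] (TensorProduct R (K.X 1) (L.X 0)) × (TensorProduct R (K.X 0) (L.X 1)) :=
    LinearEquiv.ofLinearMap (LinearMap.prod p10.hom p01.hom) (LinearMap.coprod i10.hom i01.hom)
      (by
        apply LinearMap.ext
        rintro ⟨x, y⟩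
        refine Prod.ext ?_ ?_
        · change p10.hom (i10.hom x + i01.hom y) = x
          rw [map_add, e10, ez2, add_zero]
        · change p01.hom (i10.hom x + i01.hom y) = y
          rw [map_add, e01, ez1, zero_add])
      (by
        apply LinearMap.ext
        intro x
        exact es x)
  obtain ⟨m⟩ := low_main S T (W.d 2 1).hom (W.d 1 0).hom
    (W.sc' 2 1 0).moduleCat_zero_apply e
    (by
      intro w
      rw [hS1, hT1]
      conv_lhs => rw [← es w, map_add, f10, f01, ← map_add]
      constructor
      · intro h
        have := congrArg p00.hom h
        rwa [e00, map_zero] at this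
      · intro h
        exact (congrArg i00.hom h).trans (map_zero _))
    (by
      intro w
      rw [hS1, hT1, hS2, hT2]
      constructor
      · rintro ⟨v, rfl⟩
        refine ⟨p20.hom v, p11.hom v, p02.hom v, ?_, ?_⟩
        · change p10.hom _ = _
          conv_lhs => rw [← et v]
          simp only [map_add, f20, f11, f02, map_sub, e10, e01, ez1, ez2]
          abel
        · change p01.hom _ = _
          conv_lhs => rw [← et v]
          simp only [map_add, f20, f11, f02, map_sub, e10, e01, ez1, ez2]
          abel
      · rintro ⟨x, y, z, h1, h2⟩
        refine ⟨i20.hom x + i11.hom y + i02.hom z, ?_⟩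
        change p10.hom w = _ at h1
        change p01.hom w = _ at h2
        rw [← es w, h1, h2]
        simp only [map_add, f20, f11, f02, map_sub]
        abel)
  rw [hT3] at m
  exact ⟨(hom1 W).trans (m.trans (LinearEquiv.prodCongr (LinearEquiv.refl R _)
    (LinearEquiv.prodCongr (LinearEquiv.refl R _) t.symm)))⟩
end Combo

section Tens
variable (C D : ChainComplex (ModuleCat.{0} ℤ) ℕ)

/-- The inclusion of a summand. -/
noncomputable def inc (p q n : ℕ) (h : p + q = n) : C.X p ⊗ D.X q ⟶ (tensorComplex C D).X n :=
  HomologicalComplex.ιMapBifunctor C D (curriedTensor (ModuleCat ℤ)) (ComplexShape.down ℕ) p q n h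

/-- The projection to a summand. -/
noncomputable def prj (p q n : ℕ) : (tensorComplex C D).X n ⟶ C.X p ⊗ D.X q :=
  HomologicalComplex.mapBifunctorDesc (fun p' q' _ =>
    if h : p' = p ∧ q' = q then eqToHom (by obtain ⟨rfl, rfl⟩ := h; rfl) else 0)

lemma inc_prj_self (p q n : ℕ) (h : p + q = n) : inc C D p q n h ≫ prj C D p q n = 𝟙 _ := by
  refine (HomologicalComplex.ι_mapBifunctorDesc _ p q h).trans ?_
  simp

lemma inc_prj_ne (p q p' q' n : ℕ) (h : p + q = n) (hne : p ≠ p') :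
    inc C D p q n h ≫ prj C D p' q' n = 0 := by
  refine (HomologicalComplex.ι_mapBifunctorDesc _ p q h).trans ?_
  rw [dif_neg (fun h => hne h.1)]

lemma inc_ext {n : ℕ} {Y : ModuleCat.{0} ℤ} {f g : (tensorComplex C D).X n ⟶ Y}
    (h : ∀ p q (h : p + q = n), inc C D p q n h ≫ f = inc C D p q n h ≫ g) : f = g :=
  HomologicalComplex.mapBifunctor.hom_ext h

lemma inc_d_zero (p n : ℕ) (h : p + 1 + 0 = n + 1) (h' : p + 0 = n) :
    inc C D (p + 1) 0 (n + 1) h ≫ (tensorComplex C D).d (n + 1) n =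
      (C.d (p + 1) p ▷ D.X 0) ≫ inc C D p 0 n h' := by
  rw [inc, HomologicalComplex.mapBifunctor.d_eq, Preadditive.comp_add,
    HomologicalComplex.mapBifunctor.ι_D₁, HomologicalComplex.mapBifunctor.ι_D₂,
    HomologicalComplex.mapBifunctor.d₂_eq_zero _ _ _ _ _ _ _ (by simp), add_zero,
    HomologicalComplex.mapBifunctor.d₁_eq _ _ _ _ (show (ComplexShape.down ℕ).Rel (p + 1) p by simp)
      _ _ h']
  exact one_smul ℤˣ _

lemma inc_zero_d (q n : ℕ) (h : 0 + (q + 1) = n + 1) (h' : 0 + q = n) :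
    inc C D 0 (q + 1) (n + 1) h ≫ (tensorComplex C D).d (n + 1) n =
      (C.X 0 ◁ D.d (q + 1) q) ≫ inc C D 0 q n h' := by
  rw [inc, HomologicalComplex.mapBifunctor.d_eq, Preadditive.comp_add,
    HomologicalComplex.mapBifunctor.ι_D₁, HomologicalComplex.mapBifunctor.ι_D₂,
    HomologicalComplex.mapBifunctor.d₁_eq_zero _ _ _ _ _ _ _ (by simp), zero_add,
    HomologicalComplex.mapBifunctor.d₂_eq _ _ _ _ _ (show (ComplexShape.down ℕ).Rel (q + 1) q by simp)
      _ h']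
  have : ComplexShape.ε₂ (ComplexShape.down ℕ) (ComplexShape.down ℕ) (ComplexShape.down ℕ)
    (0, q + 1) = 1 := by simp [ComplexShape.ε₂_def, ComplexShape.ε_down_ℕ]
  rw [this]
  exact one_smul ℤˣ _

lemma inc_d_one :
    inc C D 1 1 2 rfl ≫ (tensorComplex C D).d 2 1 =
      (C.d 1 0 ▷ D.X 1) ≫ inc C D 0 1 1 rfl - (C.X 1 ◁ D.d 1 0) ≫ inc C D 1 0 1 rfl := by
  rw [inc, HomologicalComplex.mapBifunctor.d_eq, Preadditive.comp_add,
    HomologicalComplex.mapBifunctor.ι_D₁, HomologicalComplex.mapBifunctor.ι_D₂,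
    HomologicalComplex.mapBifunctor.d₁_eq _ _ _ _ (show (ComplexShape.down ℕ).Rel 1 0 by simp)
      _ _ (show 0 + 1 = 1 from rfl),
    HomologicalComplex.mapBifunctor.d₂_eq _ _ _ _ _ (show (ComplexShape.down ℕ).Rel 1 0 by simp)
      _ (show 1 + 0 = 1 from rfl), sub_eq_add_neg]
  have : ComplexShape.ε₂ (ComplexShape.down ℕ) (ComplexShape.down ℕ) (ComplexShape.down ℕ)
    (1, 1) = -1 := by simp [ComplexShape.ε₂_def, ComplexShape.ε_down_ℕ]
  rw [this]
  have h2 : ComplexShape.ε₁ (ComplexShape.down ℕ) (ComplexShape.down ℕ) (ComplexShape.down ℕ)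
    (1, 1) = 1 := rfl
  rw [h2, one_smul, Units.neg_smul, one_smul]
  rfl
end Tens

lemma to_add {R A B : Type} [Semiring R] [AddCommGroup A] [AddCommGroup B] {_ : Module R A}
    {_ : Module R B} (f : Nonempty (A ≃ₗ[R] B)) : Nonempty (A ≃+ B) :=
  f.elim fun g => ⟨g.toAddEquiv⟩

lemma of_add {A B : Type} [AddCommGroup A] [AddCommGroup B] [iA : Module ℤ A]
    [iB : Module ℤ B] (f : Nonempty (A ≃+ B)) : Nonempty (A ≃ₗ[ℤ] B) :=
  f.elim fun g => ⟨{ g with map_smul' := fun n x => by simpa using map_intCast_smul g ℤ ℤ n x }⟩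

/-- Künneth in low degree: for chain complexes `C` and `D` of free abelian groups in
nonnegative degrees,
`H₁(C ⊗ D) ≅ (H₁(C) ⊗ H₀(D)) ⊕ (H₀(C) ⊗ H₁(D)) ⊕ Tor₁^ℤ(H₀(C), H₀(D))`. -/
theorem homology_one_tensor (C D : ChainComplex (ModuleCat.{0} ℤ) ℕ)
    (hC : ∀ n, Module.Free ℤ (C.X n)) (hD : ∀ n, Module.Free ℤ (D.X n)) :
    Nonempty (((tensorComplex C D).homology 1 : ModuleCat ℤ) ≃ₗ[ℤ]
      (TensorProduct ℤ (C.homology 1 : ModuleCat ℤ) (D.homology 0 : ModuleCat ℤ) ×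
        TensorProduct ℤ (C.homology 0 : ModuleCat ℤ) (D.homology 1 : ModuleCat ℤ) ×
        (((Tor (ModuleCat ℤ) 1).obj (C.homology 0)).obj (D.homology 0) : ModuleCat ℤ))) := by
  have key := combo C D (tensorComplex C D)
    (by have := hC 0; exact exists_section _) (by have := hD 0; exact exists_section _)
    (by have := hD 0; infer_instance) (by have := hD 1; infer_instance)
    (inc C D 0 0 0 rfl) (prj C D 0 0 0) (inc_prj_self _ _ _ _ _ _)
    (inc C D 1 0 1 rfl) (prj C D 1 0 1) (inc_prj_self _ _ _ _ _ _)
    (inc C D 0 1 1 rfl) (prj C D 0 1 1) (inc_prj_self _ _ _ _ _ _)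
    (inc_prj_ne _ _ _ _ _ _ _ _ (by simp)) (inc_prj_ne _ _ _ _ _ _ _ _ (by simp))
    (by
      apply inc_ext
      intro p q h
      have hp : p = 0 ∧ q = 1 ∨ p = 1 ∧ q = 0 := by omega
      rcases hp with ⟨rfl, rfl⟩ | ⟨rfl, rfl⟩
      all_goals
        rw [Preadditive.comp_add, ← Category.assoc, ← Category.assoc, inc_prj_self, inc_prj_ne]
        · simp
        · simp)
    (inc C D 2 0 2 rfl) (prj C D 2 0 2) (inc C D 1 1 2 rfl) (prj C D 1 1 2)
    (inc C D 0 2 2 rfl) (prj C D 0 2 2)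
    (by
      apply inc_ext
      intro p q h
      have hp : p = 0 ∧ q = 2 ∨ p = 1 ∧ q = 1 ∨ p = 2 ∧ q = 0 := by omega
      rcases hp with ⟨rfl, rfl⟩ | ⟨rfl, rfl⟩ | ⟨rfl, rfl⟩
      all_goals
        rw [Preadditive.comp_add, Preadditive.comp_add, ← Category.assoc, ← Category.assoc,
          ← Category.assoc, inc_prj_self, inc_prj_ne, inc_prj_ne]
        · simp
        · simp
        · simp)
    (inc_d_zero _ _ _ _ _ _) (inc_zero_d _ _ _ _ _ _) (inc_d_zero _ _ _ _ _ _)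
    (inc_d_one _ _) (inc_zero_d _ _ _ _ _ _)
  exact of_add (to_add key)
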